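/- arXiv:1308.2648 — 2 statements merged into one kernel-verified Lean document; each statement's English description precedes it below -/
import Mathlib

section
/- Let H be a real Hilbert space and p > 2. For all x, y ∈ H one has ‖x+y‖^p − ‖x‖^p − p·‖x‖^(p−2)·⟨x, y⟩ ≤ (p(p−1)/2)·(‖x‖ + ‖y‖)^(p−2)·‖y‖², where the term ‖x‖^(p−2)·⟨x, y⟩ is interpreted as 0 when x = 0. -/
open RealInnerProductSpace

/-- Tangent line inequality for `t ↦ t ^ r` at the larger of the two points. -/
lemma rpow_sub_rpow_le_mul_sub {r s t : ℝ} (hr : 1 ≤ r) (hs : 0 ≤ s) (hst : s ≤ t) :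
    t ^ r - s ^ r ≤ r * t ^ (r - 1) * (t - s) := by
  rcases hst.eq_or_lt with rfl | hlt
  · simp
  · have h := (convexOn_rpow hr).slope_le_of_hasDerivAt (Set.mem_Ici.2 hs)
      (Set.mem_Ici.2 (hs.trans hst)) hlt (Real.hasDerivAt_rpow_const (Or.inr hr))
    rwa [slope_def_field, div_le_iff₀ (sub_pos.2 hlt)] at h

/-- The odd power function `s ↦ |s| ^ q * s` is Lipschitz on `[-M, M]` with constant
`(q + 1) * M ^ q`. -/
lemma abs_rpow_mul_self_sub_le {q M s t : ℝ} (hq : 0 < q) (hs : -M ≤ s) (hst : s ≤ t)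
    (ht : t ≤ M) : |t| ^ q * t - |s| ^ q * s ≤ (q + 1) * M ^ q * (t - s) := by
  have same_sign : ∀ {u v : ℝ}, 0 ≤ u → u ≤ v → v ≤ M →
      v ^ q * v - u ^ q * u ≤ (q + 1) * M ^ q * (v - u) := by
    intro u v hu huv hv
    have h := rpow_sub_rpow_le_mul_sub (r := q + 1) (by linarith) hu huv
    rw [Real.rpow_add_one' (hu.trans huv) (by linarith), Real.rpow_add_one' hu (by linarith),
      add_sub_cancel_right] at h
    have hvM : v ^ q ≤ M ^ q := Real.rpow_le_rpow (hu.trans huv) hv hq.le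
    have huv' : 0 ≤ v - u := sub_nonneg.2 huv
    exact h.trans (by gcongr)
  rcases le_total 0 s with h0s | hs0
  · rw [abs_of_nonneg h0s, abs_of_nonneg (h0s.trans hst)]
    exact same_sign h0s hst ht
  rcases le_total 0 t with h0t | ht0
  · have h₁ := same_sign le_rfl h0t ht
    have h₂ := same_sign le_rfl (neg_nonneg.2 hs0) (neg_le.1 hs)
    rw [abs_of_nonneg h0t, abs_of_nonpos hs0]
    linarith
  · have h := same_sign (neg_nonneg.2 ht0) (neg_le_neg hst) (neg_le.1 hs)
    rw [abs_of_nonpos ht0, abs_of_nonpos hs0]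
    linarith

/-- Second order Taylor upper bound for `s ↦ |s| ^ p` on `[-M, M]`. -/
lemma abs_rpow_taylor_two_upper {p M a s : ℝ} (hp : 2 < p) (ha : a ∈ Set.Icc (-M) M)
    (hs : s ∈ Set.Icc (-M) M) :
    |s| ^ p - |a| ^ p - p * |a| ^ (p - 2) * a * (s - a) ≤
      p * (p - 1) / 2 * M ^ (p - 2) * (s - a) ^ 2 := by
  set K : ℝ := p * (p - 1) / 2 * M ^ (p - 2) with hK
  let G : ℝ → ℝ := fun u => K * u ^ 2 - |u| ^ p
  have hG : ∀ u, HasDerivAt G (K * (2 * u) - p * |u| ^ (p - 2) * u) u := fun u => by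
    have h := ((hasDerivAt_pow 2 u).const_mul K).sub (hasDerivAt_abs_rpow u (p := p) (by linarith))
    simp only [Nat.cast_ofNat, Nat.add_one_sub_one, pow_one] at h
    exact h
  have hconv : ConvexOn ℝ (Set.Icc (-M) M) G := by
    refine MonotoneOn.convexOn_of_deriv (convex_Icc _ _)
      (fun u _ => (hG u).continuousAt.continuousWithinAt)
      (fun u _ => (hG u).differentiableAt.differentiableWithinAt) ?_
    intro u hu v hv huv
    have hu' := interior_subset hu
    have hv' := interior_subset hv
    rw [(hG u).deriv, (hG v).deriv]
    have h := mul_le_mul_of_nonneg_left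
      (abs_rpow_mul_self_sub_le (q := p - 2) (by linarith) hu'.1 huv hv'.2)
      (by linarith : (0 : ℝ) ≤ p)
    rw [hK]
    linarith
  have tangent : (K * (2 * a) - p * |a| ^ (p - 2) * a) * (s - a) ≤ G s - G a := by
    rcases lt_trichotomy a s with h | rfl | h
    · have := hconv.le_slope_of_hasDerivAt ha hs h (hG a)
      rwa [slope_def_field, le_div_iff₀ (sub_pos.2 h)] at this
    · simp
    · have := hconv.slope_le_of_hasDerivAt hs ha h (hG a)
      rw [slope_def_field, div_le_iff₀ (sub_pos.2 h)] at this
      linarith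
  simp only [G] at tangent
  linarith

/-- Let `H` be a real Hilbert space and `p > 2`. For all `x, y ∈ H`,
`‖x+y‖^p − ‖x‖^p − p·‖x‖^(p−2)·⟪x, y⟫ ≤ (p(p−1)/2)·(‖x‖+‖y‖)^(p−2)·‖y‖²`.
(When `x = 0` the inner-product term vanishes, since `⟪0, y⟫ = 0` and `0^(p−2) = 0`,
in accordance with the convention that it is interpreted as `0` there.) -/
theorem rpow_norm_taylor_two_upper {H : Type*} [NormedAddCommGroup H]
    [InnerProductSpace ℝ H] [CompleteSpace H] (p : ℝ) (hp : 2 < p) (x y : H) :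
    ‖x + y‖ ^ p - ‖x‖ ^ p - p * ‖x‖ ^ (p - 2) * ⟪x, y⟫ ≤
      p * (p - 1) / 2 * (‖x‖ + ‖y‖) ^ (p - 2) * ‖y‖ ^ 2 := by
  have hc := abs_le.1 (abs_real_inner_le_norm x y)
  have hxy := norm_add_sq_real x y
  have sq_rpow : ∀ u : ℝ, (u ^ 2) ^ (p / 2) = |u| ^ p := fun u => by
    rw [← sq_abs, ← Real.rpow_natCast, ← Real.rpow_mul (abs_nonneg u)]
    congr 1
    push_cast
    ring
  have hnorm : (‖x‖ ^ 2 + 2 * ⟪x, y⟫ + ‖y‖ ^ 2) ^ (p / 2) = ‖x + y‖ ^ p := by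
    rw [← hxy, sq_rpow, abs_norm]
  generalize ‖x + y‖ ^ p = N at *
  have ha := norm_nonneg x
  have hb := norm_nonneg y
  generalize ‖x‖ = a at *
  generalize ‖y‖ = b at *
  generalize ⟪x, y⟫ = c at *
  -- As a function of the inner product the left-hand side is convex, so it suffices to bound it
  -- at the two endpoints allowed by Cauchy-Schwarz.
  let F : ℝ → ℝ := fun d => (a ^ 2 + 2 * d + b ^ 2) ^ (p / 2) - p * a ^ (p - 2) * d
  have hF : ConvexOn ℝ (Set.Icc (-(a * b)) (a * b)) F := by
    refine ⟨convex_Icc _ _, fun u hu v hv α β hα hβ hαβ => ?_⟩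
    have h := (convexOn_rpow (p := p / 2) (by linarith)).2
      (x := a ^ 2 + 2 * u + b ^ 2) (Set.mem_Ici.2 (by nlinarith [hu.1, sq_nonneg (a - b)]))
      (y := a ^ 2 + 2 * v + b ^ 2) (Set.mem_Ici.2 (by nlinarith [hv.1, sq_nonneg (a - b)]))
      hα hβ hαβ
    have e : α • (a ^ 2 + 2 * u + b ^ 2) + β • (a ^ 2 + 2 * v + b ^ 2) =
        a ^ 2 + 2 * (α • u + β • v) + b ^ 2 := by
      simp only [smul_eq_mul]
      linear_combination (a ^ 2 + b ^ 2) * hαβ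
    rw [e] at h
    simp only [F, smul_eq_mul] at h ⊢
    linarith
  have hmax := hF.le_max_of_mem_Icc (Set.left_mem_Icc.2 (hc.1.trans hc.2))
    (Set.right_mem_Icc.2 (hc.1.trans hc.2)) ⟨hc.1, hc.2⟩
  have hmem : a ∈ Set.Icc (-(a + b)) (a + b) := ⟨by linarith, by linarith⟩
  have hminus := abs_rpow_taylor_two_upper hp hmem
    (s := a - b) ⟨by linarith, by linarith⟩
  have hplus := abs_rpow_taylor_two_upper hp hmem
    (s := a + b) ⟨by linarith, by linarith⟩
  rw [abs_of_nonneg ha, ← sq_rpow] at hminus hplus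
  simp only [F] at hmax
  rw [hnorm, show a ^ 2 + 2 * -(a * b) + b ^ 2 = (a - b) ^ 2 by ring,
    show a ^ 2 + 2 * (a * b) + b ^ 2 = (a + b) ^ 2 by ring] at hmax
  rcases le_max_iff.1 hmax with h | h <;> linarith
end

section
/- (Sz.-Nagy dilation of a contraction semigroup.) Let H be a real Hilbert space and let (S(t))_{t ≥ 0} be a strongly continuous semigroup of contractions on H; that is, each S(t) : H → H is a continuous linear map with operator norm at most 1, S(0) = id, S(s+t) = S(s) ∘ S(t) for all s, t ≥ 0, and for each x ∈ H the map t ↦ S(t)x is continuous on [0, ∞). Then there exist a real Hilbert space H̄, a linear isometry ι : H → H̄, and a family (U(t))_{t ∈ ℝ} of unitary operators on H̄ with U(0) = id, U(s+t) = U(s) ∘ U(t) for all s, t ∈ ℝ, and t ↦ U(t)y continuous on ℝ for each y ∈ H̄, such that for all t ≥ 0 and all x ∈ H one has ι(S(t)x) = P(U(t)(ι x)), where P denotes the orthogonal projection of H̄ onto the closed subspace ι(H). -/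
open RealInnerProductSpace NNReal

universe u

/-- A Sz.-Nagy unitary dilation of a semigroup `S` of operators on a real Hilbert space `H`:
a real Hilbert space `carrier`, a linear isometry `ι : H → carrier`, a strongly continuous
group `U` of unitary (i.e. surjective isometric) operators on `carrier`, and the orthogonal
projection `P` of `carrier` onto the range of `ι` (characterized by taking values in the range
of `ι`, with `y - P y` orthogonal to the range of `ι`), such that
`ι (S t x) = P (U t (ι x))` for all `t ≥ 0` and `x ∈ H`. -/
structure SzNagyDilation (H : Type u) [NormedAddCommGroup H] [InnerProductSpace ℝ H]
    [CompleteSpace H] (S : ℝ≥0 → H →L[ℝ] H) where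
  carrier : Type u
  [norm_inst : NormedAddCommGroup carrier]
  [inner_inst : InnerProductSpace ℝ carrier]
  [complete_inst : CompleteSpace carrier]
  ι : H →ₗᵢ[ℝ] carrier
  U : ℝ → carrier →L[ℝ] carrier
  U_isometry : ∀ (t : ℝ) (y : carrier), ‖U t y‖ = ‖y‖
  U_surjective : ∀ t : ℝ, Function.Surjective (U t)
  U_zero : U 0 = ContinuousLinearMap.id ℝ carrier
  U_add : ∀ s t : ℝ, U (s + t) = (U s).comp (U t)
  U_continuous : ∀ y : carrier, Continuous fun t : ℝ => U t y
  P : carrier →L[ℝ] carrier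
  P_mem_range : ∀ y : carrier, ∃ x : H, P y = ι x
  P_orthogonal : ∀ (y : carrier) (x : H), ⟪y - P y, ι x⟫ = 0
  dilation : ∀ (t : ℝ≥0) (x : H), ι (S t x) = P (U (t : ℝ) (ι x))

namespace SzNagy

open ContinuousLinearMap

variable {H : Type u} [NormedAddCommGroup H] [InnerProductSpace ℝ H] {S : ℝ≥0 → H →L[ℝ] H}

/-- Quantitative positive definiteness of a contraction semigroup: if `a` is a lower bound of
the finite set `s` of times, then the kernel form of a family of vectors indexed by `s` dominates
the squared norm of `∑ t ∈ s, S (t - a) (x t)`. -/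
theorem sq_norm_sum_le_sum_inner (hS_zero : S 0 = ContinuousLinearMap.id ℝ H)
    (hS_add : ∀ s t : ℝ≥0, S (s + t) = (S s).comp (S t))
    (hS_contraction : ∀ t, ‖S t‖ ≤ 1) (x : ℝ → H) (s : Finset ℝ) (a : ℝ) (ha : ∀ t ∈ s, a ≤ t) :
    ‖∑ t ∈ s, S (t - a).toNNReal (x t)‖ ^ 2 ≤
      ∑ t ∈ s, ∑ r ∈ s, ⟪S (t - r).toNNReal (x t), S (r - t).toNNReal (x r)⟫ := by
  induction s using Finset.induction_on_min generalizing a with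
  | empty => simp
  | insert b s hb ih =>
    have hbs : b ∉ s := fun h => lt_irrefl b (hb b h)
    have hab : a ≤ b := ha b (Finset.mem_insert_self b s)
    set w := ∑ t ∈ s, S (t - b).toNNReal (x t) with hw
    have hfactor : ∑ t ∈ insert b s, S (t - a).toNNReal (x t) =
        S (b - a).toNNReal (x b + w) := by
      rw [Finset.sum_insert hbs, map_add, hw, map_sum]
      congr 1
      refine Finset.sum_congr rfl fun t ht => ?_
      rw [← ContinuousLinearMap.comp_apply, ← hS_add,
        ← Real.toNNReal_add (sub_nonneg.2 hab) (sub_nonneg.2 (hb t ht).le)]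
      ring_nf
    have hnorm : ‖S (b - a).toNNReal (x b + w)‖ ≤ ‖x b + w‖ := by
      simpa using (S (b - a).toNNReal).le_of_opNorm_le (hS_contraction _) (x b + w)
    have hrow : ∑ r ∈ s, ⟪S (b - r).toNNReal (x b), S (r - b).toNNReal (x r)⟫ = ⟪x b, w⟫ := by
      rw [hw, inner_sum]
      refine Finset.sum_congr rfl fun r hr => ?_
      rw [Real.toNNReal_of_nonpos (sub_nonpos.2 (hb r hr).le), hS_zero,
        ContinuousLinearMap.id_apply]
    have hcol : ∑ t ∈ s, ⟪S (t - b).toNNReal (x t), S (b - t).toNNReal (x b)⟫ = ⟪x b, w⟫ := by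
      rw [← hrow]
      exact Finset.sum_congr rfl fun t _ => real_inner_comm _ _
    have hih := ih b fun t ht => (hb t ht).le
    simp only [Finset.sum_insert hbs, Finset.sum_add_distrib, hrow, hcol, sub_self,
      Real.toNNReal_zero, hS_zero, ContinuousLinearMap.id_apply, real_inner_self_eq_norm_sq]
    rw [← Finset.sum_insert (f := fun t => S (t - a).toNNReal (x t)) hbs, hfactor]
    calc ‖S (b - a).toNNReal (x b + w)‖ ^ 2 ≤ ‖x b + w‖ ^ 2 := by gcongr
      _ = ‖x b‖ ^ 2 + 2 * ⟪x b, w⟫ + ‖w‖ ^ 2 := norm_add_sq_real _ _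
      _ ≤ _ := by linarith

theorem sum_inner_nonneg (hS_zero : S 0 = ContinuousLinearMap.id ℝ H)
    (hS_add : ∀ s t : ℝ≥0, S (s + t) = (S s).comp (S t))
    (hS_contraction : ∀ t, ‖S t‖ ≤ 1) (x : ℝ → H) (s : Finset ℝ) :
    0 ≤ ∑ t ∈ s, ∑ r ∈ s, ⟪S (t - r).toNNReal (x t), S (r - t).toNNReal (x r)⟫ := by
  obtain ⟨a, ha⟩ := s.bddBelow
  exact (sq_nonneg _).trans
    (sq_norm_sum_le_sum_inner hS_zero hS_add hS_contraction x s a fun t ht => ha ht)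

/-- The operator-valued kernel `(s, t) ↦ S ((s - t)⁺)† S ((t - s)⁺)` of a semigroup `S`. -/
noncomputable def semigroupKernel [CompleteSpace H] (S : ℝ≥0 → H →L[ℝ] H) :
    Matrix ℝ ℝ (H →L[ℝ] H) :=
  .of fun s t => (S (s - t).toNNReal).adjoint ∘L S (t - s).toNNReal

theorem inner_semigroupKernel_apply [CompleteSpace H] (s t : ℝ) (x y : H) :
    ⟪semigroupKernel S s t x, y⟫ = ⟪S (t - s).toNNReal x, S (s - t).toNNReal y⟫ := by
  simp [semigroupKernel, adjoint_inner_left]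

theorem posSemidef_semigroupKernel [CompleteSpace H] (hS_zero : S 0 = ContinuousLinearMap.id ℝ H)
    (hS_add : ∀ s t : ℝ≥0, S (s + t) = (S s).comp (S t))
    (hS_contraction : ∀ t, ‖S t‖ ≤ 1) : (semigroupKernel S).PosSemidef := by
  have htfae := (RKHS.posSemidef_tfae (K := semigroupKernel S)).out 0 2
  refine htfae.mpr ⟨?_, fun x => ?_⟩
  · ext s t : 1
    simp [semigroupKernel, star_eq_adjoint, adjoint_comp]
  · simpa only [inner_semigroupKernel_apply, Finsupp.sum, RCLike.re_to_real] using
      sum_inner_nonneg hS_zero hS_add hS_contraction x x.support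

section Gram

variable {ι E F : Type*} [NormedAddCommGroup E] [InnerProductSpace ℝ E]
  [NormedAddCommGroup F] [InnerProductSpace ℝ F]

theorem norm_linearCombination_eq_of_inner_eq {v : ι → E} {w : ι → F}
    (h : ∀ i j, ⟪v i, v j⟫ = ⟪w i, w j⟫) (c : ι →₀ ℝ) :
    ‖Finsupp.linearCombination ℝ v c‖ = ‖Finsupp.linearCombination ℝ w c‖ := by
  rw [← sq_eq_sq₀ (norm_nonneg _) (norm_nonneg _), ← real_inner_self_eq_norm_sq,
    ← real_inner_self_eq_norm_sq]
  simp only [Finsupp.linearCombination_apply, Finsupp.sum_inner, Finsupp.inner_sum,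
    inner_smul_left, inner_smul_right, h]

/-- A family with dense span and any other family with the same Gram matrix are related by a
linear isometry. -/
theorem exists_linearIsometry_of_inner_eq [CompleteSpace F] {v : ι → E} {w : ι → F}
    (hv : Dense (Submodule.span ℝ (Set.range v) : Set E))
    (h : ∀ i j, ⟪v i, v j⟫ = ⟪w i, w j⟫) : ∃ T : E →ₗᵢ[ℝ] F, ∀ i, T (v i) = w i := by
  have hnorm := norm_linearCombination_eq_of_inner_eq h
  have hdense : DenseRange (Finsupp.linearCombination ℝ v) := by
    rwa [DenseRange, ← LinearMap.coe_range, Finsupp.range_linearCombination]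
  have hbound : ∃ C, ∀ c, ‖Finsupp.linearCombination ℝ w c‖ ≤
      C * ‖Finsupp.linearCombination ℝ v c‖ := ⟨1, fun c => by rw [one_mul, hnorm]⟩
  set T := (Finsupp.linearCombination ℝ w).extendOfNorm (Finsupp.linearCombination ℝ v)
  have hTv : ∀ c, T (Finsupp.linearCombination ℝ v c) = Finsupp.linearCombination ℝ w c :=
    fun c => LinearMap.extendOfNorm_eq hdense hbound c
  refine ⟨⟨T.toLinearMap, fun y => ?_⟩, fun i => ?_⟩
  · refine hdense.induction_on (p := fun y => ‖T y‖ = ‖y‖) y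
      (isClosed_eq (by fun_prop) (by fun_prop)) fun c => ?_
    rw [hTv, hnorm]
  · simpa using hTv (Finsupp.single i 1)

end Gram

/-- A family `t ↦ δ t` of continuous linear maps from `H` with translation invariant Gram kernel, strong
continuity and dense span carries a strongly continuous unitary group that translates it. -/
theorem exists_translation_group {E : Type*} [NormedAddCommGroup E] [InnerProductSpace ℝ E]
    [CompleteSpace E] {δ : ℝ → H →L[ℝ] E}
    (hdense : Dense (Submodule.span ℝ (Set.range fun p : ℝ × H => δ p.1 p.2) : Set E))
    (hinv : ∀ (r s t : ℝ) (x y : H), ⟪δ (r + s) x, δ (r + t) y⟫ = ⟪δ s x, δ t y⟫)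
    (hcont : ∀ x : H, Continuous fun t => δ t x) :
    ∃ U : ℝ → E →ₗᵢ[ℝ] E, (∀ r t x, U r (δ t x) = δ (r + t) x) ∧ (∀ y, U 0 y = y) ∧
      (∀ s t y, U (s + t) y = U s (U t y)) ∧ ∀ y, Continuous fun t => U t y := by
  choose U hU using fun r : ℝ => exists_linearIsometry_of_inner_eq hdense
    (w := fun p : ℝ × H => δ (r + p.1) p.2) fun i j => (hinv r i.1 j.1 i.2 j.2).symm
  have hUδ : ∀ r t x, U r (δ t x) = δ (r + t) x := fun r t x => hU r (t, x)
  have hext : ∀ A B : E →L[ℝ] E, (∀ t x, A (δ t x) = B (δ t x)) → A = B := fun A B h =>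
    ContinuousLinearMap.ext_on hdense (by rintro _ ⟨p, rfl⟩; exact h p.1 p.2)
  refine ⟨U, hUδ, fun y => ?_, fun s t y => ?_, fun y => ?_⟩
  · exact DFunLike.congr_fun (hext (U 0).toContinuousLinearMap (.id ℝ E) (by simp [hUδ])) y
  · exact DFunLike.congr_fun (hext (U (s + t)).toContinuousLinearMap
      ((U s).toContinuousLinearMap ∘L (U t).toContinuousLinearMap)
      (by simp [hUδ, add_assoc])) y
  · have hspan : ∀ z ∈ Submodule.span ℝ (Set.range fun p : ℝ × H => δ p.1 p.2),
        Continuous fun t => U t z := by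
      intro z hz
      induction hz using Submodule.span_induction with
      | mem z hz =>
        obtain ⟨p, rfl⟩ := hz
        simp only [hUδ]
        exact (hcont p.2).comp (continuous_id.add continuous_const)
      | zero => simpa using continuous_const
      | add z w _ _ hz hw => simpa using! hz.add hw
      | smul c z _ hz => simpa using! hz.const_smul c
    refine continuous_of_uniform_approx_of_continuous fun u hu => ?_
    obtain ⟨ε, hε, hεu⟩ := Metric.mem_uniformity_dist.1 hu
    obtain ⟨z, hz, hyz⟩ := hdense.exists_dist_lt y hε
    exact ⟨fun t => U t z, hspan z hz, fun t => hεu (by rwa [(U t).dist_map])⟩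

/-- If the Gram kernel of `t ↦ δ t x` is that of the semigroup, the map is continuous. -/
theorem continuous_of_inner_eq {E : Type*} [NormedAddCommGroup E] [InnerProductSpace ℝ E]
    (hS_zero : S 0 = ContinuousLinearMap.id ℝ H)
    (hS_continuous : ∀ x : H, Continuous fun t : ℝ≥0 => S t x) {δ : ℝ → H → E}
    (hδ : ∀ s t x y, ⟪δ s x, δ t y⟫ = ⟪S (s - t).toNNReal x, S (t - s).toNNReal y⟫) (x : H) :
    Continuous fun t => δ t x := by
  have hself : ∀ t, ‖δ t x‖ ^ 2 = ‖x‖ ^ 2 := fun t => by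
    rw [← real_inner_self_eq_norm_sq, hδ]
    simp [hS_zero]
  rw [continuous_iff_continuousAt]
  intro a
  rw [ContinuousAt, tendsto_iff_norm_sub_tendsto_zero]
  have hsq : Continuous fun t =>
      √(2 * ‖x‖ ^ 2 - 2 * ⟪S (t - a).toNNReal x, S (a - t).toNNReal x⟫) := by
    have h₁ : Continuous fun t => S (t - a).toNNReal x := (hS_continuous x).comp (by fun_prop)
    have h₂ : Continuous fun t => S (a - t).toNNReal x := (hS_continuous x).comp (by fun_prop)
    fun_prop
  convert hsq.tendsto a using 1
  · ext t
    have h : 2 * ‖x‖ ^ 2 - 2 * ⟪δ t x, δ a x⟫ = ‖δ t x - δ a x‖ ^ 2 := by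
      rw [norm_sub_sq_real, hself, hself]
      ring
    rw [← hδ, h, Real.sqrt_sq (norm_nonneg _)]
  · simp [hS_zero]

end SzNagy

/-- Sz.-Nagy's dilation theorem: every strongly continuous semigroup of contractions on a
real Hilbert space admits a unitary dilation. -/
theorem szNagy_dilation {H : Type u} [NormedAddCommGroup H] [InnerProductSpace ℝ H]
    [CompleteSpace H] (S : ℝ≥0 → H →L[ℝ] H)
    (hS_zero : S 0 = ContinuousLinearMap.id ℝ H)
    (hS_add : ∀ s t : ℝ≥0, S (s + t) = (S s).comp (S t))
    (hS_contraction : ∀ t, ‖S t‖ ≤ 1)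
    (hS_continuous : ∀ x : H, Continuous fun t : ℝ≥0 => S t x) :
    Nonempty (SzNagyDilation H S) := by
  have : Fact (SzNagy.semigroupKernel S).PosSemidef :=
    ⟨SzNagy.posSemidef_semigroupKernel hS_zero hS_add hS_contraction⟩
  let E := RKHS.OfKernel (SzNagy.semigroupKernel S)
  let δ : ℝ → H →L[ℝ] E := RKHS.kerFun E
  have hδ : ∀ s t x y, ⟪δ s x, δ t y⟫ = ⟪S (s - t).toNNReal x, S (t - s).toNNReal y⟫ := by
    intro s t x y
    rw [← RKHS.kernel_inner, RKHS.OfKernel.kernel_ofKernel, SzNagy.inner_semigroupKernel_apply]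
  have hdense : Dense (Submodule.span ℝ (Set.range fun p : ℝ × H => δ p.1 p.2) : Set E) := by
    rw [Submodule.dense_iff_topologicalClosure_eq_top, ← RKHS.kerFun_dense E]
    congr 2
    ext y
    simp [δ]
  obtain ⟨U, hUδ, hU_zero, hU_add, hU_cont⟩ := SzNagy.exists_translation_group hdense
    (fun r s t x y => by simp [hδ]) (SzNagy.continuous_of_inner_eq hS_zero hS_continuous hδ)
  let ι : H →ₗᵢ[ℝ] E := ⟨(δ 0).toLinearMap, fun x => by
    rw [← sq_eq_sq₀ (norm_nonneg _) (norm_nonneg _), ← real_inner_self_eq_norm_sq]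
    refine (hδ 0 0 x x).trans ?_
    simp [hS_zero]⟩
  exact ⟨{
    carrier := E
    ι := ι
    U := fun t => (U t).toContinuousLinearMap
    U_isometry := fun t => (U t).norm_map
    U_surjective := fun t y => ⟨U (-t) y, by simp [← hU_add, hU_zero]⟩
    U_zero := ContinuousLinearMap.ext hU_zero
    U_add := fun s t => ContinuousLinearMap.ext (hU_add s t)
    U_continuous := hU_cont
    P := ι.toContinuousLinearMap ∘L (δ 0).adjoint
    P_mem_range := fun y => ⟨(δ 0).adjoint y, rfl⟩
    P_orthogonal := fun y x => by
      have h : ⟪ι ((δ 0).adjoint y), ι x⟫ = ⟪y, δ 0 x⟫ := by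
        rw [ι.inner_map_map, ContinuousLinearMap.adjoint_inner_left]
      rw [inner_sub_left, sub_eq_zero]
      exact h.symm
    dilation := fun t x => by
      refine congrArg ι (ext_inner_right ℝ fun y => ?_)
      refine Eq.trans ?_ (ContinuousLinearMap.adjoint_inner_left (δ 0) y (U t (δ 0 x))).symm
      rw [hUδ, hδ]
      simp [hS_zero, Real.toNNReal_of_nonpos] }⟩
end
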